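/- Let G=(V,w,m,d) be a connected, locally finite weighted graph with a path metric d with finite balls, and let x, y ∈ V with x ≠ y. Let f ∈ Lip(1), let 0 < ε ≤ 1/(Deg(x) + Deg(y)), and define Hf := f + εΔf. Then |Hf(y) - Hf(x)| ≤ d(x,y)·(1 - ε·κ(x,y)). -/

import Mathlib

open Filter

namespace SalamiPaper

variable {V : Type*}

/-- Locally finite: every vertex has finitely many neighbors. -/
def LocallyFinite (w : V → V → ℝ) : Prop := ∀ x : V, {y | 0 < w x y}.Finite

/-- Connectedness of the weighted graph: any two vertices are joined by a path. -/
def GraphConnected (w : V → V → ℝ) : Prop :=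
  ∀ x y : V, Relation.ReflTransGen (fun a b => 0 < w a b) x y

/-- The weighted graph Laplacian `Δf(x) = (1/m(x)) ∑_y w(x,y)(f(y)-f(x))`. -/
noncomputable def lap (w : V → V → ℝ) (m : V → ℝ) (f : V → ℝ) (x : V) : ℝ :=
  (m x)⁻¹ * ∑ᶠ y, w x y * (f y - f x)

/-- The vertex degree `Deg(x) = (1/m(x)) ∑_y w(x,y)`. -/
noncomputable def deg (w : V → V → ℝ) (m : V → ℝ) (x : V) : ℝ :=
  (m x)⁻¹ * ∑ᶠ y, w x y

/-- The set of `d`-lengths of adjacency paths from `x` to `y`. -/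
def pathLens (w : V → V → ℝ) (d : V → V → ℝ) (x y : V) : Set ℝ :=
  {L | ∃ (n : ℕ) (p : ℕ → V), p 0 = x ∧ p n = y ∧
    (∀ i < n, 0 < w (p i) (p (i + 1))) ∧
    L = ∑ i ∈ Finset.range n, d (p i) (p (i + 1))}

/-- `d` is a path metric on the graph with edge weight `w`. -/
def IsPathMetric (w : V → V → ℝ) (d : V → V → ℝ) : Prop :=
  (∀ x, d x x = 0) ∧ (∀ x y, x ≠ y → 0 < d x y) ∧ (∀ x y, d x y = d y x) ∧
  (∀ x y z, d x z ≤ d x y + d y z) ∧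
  (∀ x y, d x y = sInf (pathLens w d x y))

/-- All balls are finite. -/
def FiniteBalls (d : V → V → ℝ) : Prop := ∀ (x : V) (R : ℝ), {y | d x y ≤ R}.Finite

/-- The combinatorial graph distance (as a real number). -/
noncomputable def combDist (w : V → V → ℝ) (x y : V) : ℝ :=
  sInf {L | ∃ (n : ℕ) (p : ℕ → V), p 0 = x ∧ p n = y ∧
    (∀ i < n, 0 < w (p i) (p (i + 1))) ∧ L = (n : ℝ)}

/-- `Lip(1)`: the 1-Lipschitz functions with respect to `d`. -/
def Lip1 (d : V → V → ℝ) (f : V → ℝ) : Prop := ∀ x y, f y - f x ≤ d x y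

/-- The Ollivier curvature
`κ(x,y) = (1/d(x,y)) inf{Δf(x) - Δf(y) : f ∈ Lip(1), f(y)-f(x) = d(x,y)}`. -/
noncomputable def kappa (w : V → V → ℝ) (m : V → ℝ) (d : V → V → ℝ) (x y : V) : ℝ :=
  (d x y)⁻¹ * sInf {c | ∃ f : V → ℝ, Lip1 d f ∧ f y - f x = d x y ∧
    c = lap w m f x - lap w m f y}

/-- `m(A) = ∞`: the total measure of `A` is infinite. -/
def InfVolume (m : V → ℝ) (A : Set V) : Prop :=
  ∀ c : ℝ, ∃ F : Finset V, ↑F ⊆ A ∧ c < ∑ x ∈ F, m x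

/-- A salami partition `(X,Y,K)`. -/
def SalamiPartition (w : V → V → ℝ) (m : V → ℝ) (X Y K : Set V) : Prop :=
  X ∪ Y ∪ K = Set.univ ∧ Disjoint X Y ∧ Disjoint X K ∧ Disjoint Y K ∧
  K.Finite ∧ (∀ x ∈ X, ∀ y ∈ Y, w x y = 0) ∧ InfVolume m X ∧ InfVolume m Y

/-- Reachability inside a subset `A` of the vertex set. -/
def reachIn (w : V → V → ℝ) (A : Set V) : V → V → Prop :=
  Relation.ReflTransGen (fun a b => a ∈ A ∧ b ∈ A ∧ 0 < w a b)

/-- The induced subgraph on `A` is connected. -/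
def ConnectedIn (w : V → V → ℝ) (A : Set V) : Prop :=
  ∀ x ∈ A, ∀ y ∈ A, reachIn w A x y

/-- A connected salami partition: `K` induces a connected subgraph. -/
def ConnectedSalamiPartition (w : V → V → ℝ) (m : V → ℝ) (X Y K : Set V) : Prop :=
  SalamiPartition w m X Y K ∧ ConnectedIn w K

/-- The basic standing assumptions on a weighted graph `G = (V,w,m,d)`:
countable vertex set, symmetric non-negative edge weight vanishing on the diagonal,
positive vertex measure, local finiteness, connectedness,
`d` a path metric with finite balls. -/
def IsGraphBase (w : V → V → ℝ) (m : V → ℝ) (d : V → V → ℝ) : Prop :=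
  Countable V ∧ (∀ x y, w x y = w y x) ∧ (∀ x y, 0 ≤ w x y) ∧ (∀ x, w x x = 0) ∧
  (∀ x, 0 < m x) ∧ LocallyFinite w ∧ GraphConnected w ∧
  IsPathMetric w d ∧ FiniteBalls d

/-- Non-negative Ollivier curvature on all edges. -/
def NonnegCurv (w : V → V → ℝ) (m : V → ℝ) (d : V → V → ℝ) : Prop :=
  ∀ x y, 0 < w x y → 0 ≤ kappa w m d x y

/-- A salami: a connected, locally finite weighted graph with a path metric with
finite balls, non-negative Ollivier curvature, admitting a salami partition. -/
def IsSalami (w : V → V → ℝ) (m : V → ℝ) (d : V → V → ℝ) : Prop :=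
  IsGraphBase w m d ∧ NonnegCurv w m d ∧ ∃ X Y K : Set V, SalamiPartition w m X Y K

/-- `G` has at least `n` ends: there is a finite set `K` such that `V ∖ K` has at
least `n` infinite connected components. -/
def atLeastEnds (w : V → V → ℝ) (n : ℕ) : Prop :=
  ∃ K : Set V, K.Finite ∧ ∃ x : Fin n → V,
    (∀ i, x i ∉ K) ∧ (∀ i, {y | reachIn w Kᶜ (x i) y}.Infinite) ∧
    (∀ i j, i ≠ j → ¬ reachIn w Kᶜ (x i) (x j))

/-- `Lip(1,K)`: functions that are 1-Lipschitz on `K`. -/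
def Lip1On (d : V → V → ℝ) (K : Set V) (f : V → ℝ) : Prop :=
  ∀ x ∈ K, ∀ y ∈ K, f y - f x ≤ d x y

open Classical in
/-- The extremal Lipschitz extension operator `S(P)` of the salami partition
`P = (X,Y,K)`. -/
noncomputable def Sop (d : V → V → ℝ) (X Y K : Set V) (f : V → ℝ) : V → ℝ :=
  fun v =>
    if v ∈ K then f v
    else if v ∈ X then sSup {c | ∃ u ∈ K, c = f u - d v u}
    else sInf {c | ∃ u ∈ K, c = f u + d v u}

/-- `ℱ(P) = S(P)(Lip(1,K))`. -/
def calF (d : V → V → ℝ) (X Y K : Set V) : Set (V → ℝ) :=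
  {g | ∃ f : V → ℝ, Lip1On d K f ∧ g = Sop d X Y K f}

/-- `ℋ(P)`: the harmonic functions in `ℱ(P)`. -/
def calH (w : V → V → ℝ) (m : V → ℝ) (d : V → V → ℝ) (X Y K : Set V) :
    Set (V → ℝ) :=
  {g | g ∈ calF d X Y K ∧ ∀ x, lap w m g x = 0}

/-- `∇₊f(x) = max_{y∼x} (f(y)-f(x))/d(x,y)`. -/
noncomputable def gradPlus (w : V → V → ℝ) (d : V → V → ℝ) (f : V → ℝ) (x : V) : ℝ :=
  sSup {c | ∃ y, 0 < w x y ∧ c = (f y - f x) / d x y}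

/-- `∇₋f(x) = max_{y∼x} (f(x)-f(y))/d(x,y)`. -/
noncomputable def gradMinus (w : V → V → ℝ) (d : V → V → ℝ) (f : V → ℝ) (x : V) : ℝ :=
  sSup {c | ∃ y, 0 < w x y ∧ c = (f x - f y) / d x y}

/-- `|∇f|(x) = max_{y∼x} |f(y)-f(x)|/d(x,y)`. -/
noncomputable def gradAbs (w : V → V → ℝ) (d : V → V → ℝ) (f : V → ℝ) (x : V) : ℝ :=
  sSup {c | ∃ y, 0 < w x y ∧ c = |f y - f x| / d x y}

/-- Recurrence: for every `ε > 0` there is a finitely supported `f` with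
`‖f‖∞ = 1` and `-⟨f, Δf⟩ < ε`. -/
def Recurrent (w : V → V → ℝ) (m : V → ℝ) : Prop :=
  ∀ ε : ℝ, 0 < ε → ∃ f : V → ℝ, (Function.support f).Finite ∧
    (∀ x, |f x| ≤ 1) ∧ (∃ x, |f x| = 1) ∧
    -(∑ᶠ x, f x * lap w m f x * m x) < ε

open Classical in
/-- `∑_{x,y : f(y) < 0 ≤ f(x)} w(x,y)(f(x)-f(y))`. -/
noncomputable def cutSum (w : V → V → ℝ) (f : V → ℝ) : ℝ :=
  ∑ᶠ p : V × V, if f p.2 < 0 ∧ 0 ≤ f p.1 then w p.1 p.2 * (f p.1 - f p.2) else 0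

/-- Subexponential growth: `max_{B_r(x)} |u| = e^{o(r)}` as `r → ∞`. -/
def SubexpGrowth (d : V → V → ℝ) (x : V) (u : V → ℝ) : Prop :=
  Filter.Tendsto
    (fun r : ℕ => Real.log (sSup {c | ∃ y, d x y ≤ (r : ℝ) ∧ c = |u y|}) / (r : ℝ))
    Filter.atTop (nhds 0)


/-- If the increments of `f` at `x` exceed those of `g` by at most `c`, then
`Δf(x) ≤ Δg(x) + c Deg(x)`. -/
theorem lap_le_lap_add_mul_deg {w : V → V → ℝ} {m : V → ℝ} {x : V}
    (hw : ∀ z, 0 ≤ w x z) (hfin : {z | 0 < w x z}.Finite) (hm : 0 < m x)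
    {f g : V → ℝ} {c : ℝ} (h : ∀ z, f z - f x ≤ g z - g x + c) :
    lap w m f x ≤ lap w m g x + c * deg w m x := by
  have hsupp : (Function.support (w x)).Finite :=
    hfin.subset fun z hz => lt_of_le_of_ne (hw z) (Ne.symm hz)
  have hmul (F : V → ℝ) : (Function.support fun z => w x z * F z).Finite :=
    hsupp.subset (Function.support_mul_subset_left _ _)
  have key : ∑ᶠ z, w x z * (f z - f x) ≤
      ∑ᶠ z, w x z * (g z - g x) + (∑ᶠ z, w x z) * c := by
    rw [finsum_mul' _ _ hsupp, ← finsum_add_distrib (hmul _) (hmul fun _ => c)]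
    simp_rw [← mul_add]
    exact finsum_le_finsum' (hmul _) (hmul _) fun z => mul_le_mul_of_nonneg_left (h z) (hw z)
  have := mul_le_mul_of_nonneg_left key (inv_nonneg.2 hm.le)
  unfold lap deg
  linarith

/-- The Lipschitz functions in the definition of `κ(x,y)` bound it from above. -/
theorem dist_mul_kappa_le {w : V → V → ℝ} {m : V → ℝ} {d : V → V → ℝ}
    (hB : IsGraphBase w m d) {x y : V} (hxy : x ≠ y) {g : V → ℝ} (hg : Lip1 d g)
    (hgxy : g y - g x = d x y) :
    d x y * kappa w m d x y ≤ lap w m g x - lap w m g y := by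
  obtain ⟨-, -, hw, -, hm, hfin, -, ⟨hd0, hdpos, hdsymm, -, -⟩, -⟩ := hB
  rw [kappa, mul_inv_cancel_left₀ (hdpos x y hxy).ne']
  refine csInf_le ⟨lap w m (fun z => -d x z) x - lap w m (d y) y, ?_⟩ ⟨g, hg, hgxy, rfl⟩
  rintro _ ⟨f, hf, -, rfl⟩
  have hx : lap w m (fun z => -d x z) x ≤ lap w m f x + 0 * deg w m x :=
    lap_le_lap_add_mul_deg (hw x) (hfin x) (hm x) fun z => by
      linarith [hf z x, hd0 x, hdsymm x z]
  have hy : lap w m f y ≤ lap w m (d y) y + 0 * deg w m y :=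
    lap_le_lap_add_mul_deg (hw y) (hfin y) (hm y) fun z => by
      linarith [hf y z, hd0 y]
  linarith

/-- The one-sided discrete-time Lipschitz contraction. -/
theorem discrete_time_lip_contraction_sub {w : V → V → ℝ} {m : V → ℝ} {d : V → V → ℝ}
    (hB : IsGraphBase w m d) {x y : V} (hxy : x ≠ y) {f : V → ℝ} (hf : Lip1 d f)
    {ε : ℝ} (hε : 0 < ε) (hε' : ε ≤ 1 / (deg w m x + deg w m y)) :
    (f y + ε * lap w m f y) - (f x + ε * lap w m f x) ≤
      d x y * (1 - ε * kappa w m d x y) := by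
  have ⟨_, _, hw, _, hm, hfin, _, ⟨hd0, _, hdsymm, htri, _⟩, _⟩ := hB
  set δ : ℝ := d x y - (f y - f x) with hδ
  have hδ0 : 0 ≤ δ := sub_nonneg.2 (hf x y)
  let g : V → ℝ := fun z => max (f z) (f y + δ - d z y)
  have hfg (z : V) : f z ≤ g z := le_max_left _ _
  have hgf (z : V) : g z ≤ f z + δ :=
    max_le (by linarith) (by linarith [hf z y])
  have hgx : g x = f x := max_eq_left (by linarith)
  have hgy : g y = f y + δ := by
    simp only [g, hd0, sub_zero]
    exact max_eq_right (by linarith)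
  have hg : Lip1 d g := fun a b => by
    have ha : f a ≤ g a := hfg a
    have ha' : f y + δ - d a y ≤ g a := le_max_right _ _
    have hb : g b ≤ g a + d a b :=
      max_le (by linarith [hf a b]) (by linarith [htri a b y])
    linarith
  have hκ := dist_mul_kappa_le hB hxy hg (by linarith)
  have hy : lap w m f y ≤ lap w m g y + δ * deg w m y :=
    lap_le_lap_add_mul_deg (hw y) (hfin y) (hm y) fun z => by linarith [hfg z]
  have hx : lap w m g x ≤ lap w m f x + δ * deg w m x :=
    lap_le_lap_add_mul_deg (hw x) (hfin x) (hm x) fun z => by linarith [hgf z]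
  have hdeg : 0 < deg w m x + deg w m y := one_div_pos.1 (hε.trans_le hε')
  have hεδ : δ * (ε * (deg w m x + deg w m y)) ≤ δ * 1 :=
    mul_le_mul_of_nonneg_left ((le_div_iff₀ hdeg).1 hε') hδ0
  have hlap : ε * (lap w m f y - lap w m f x + d x y * kappa w m d x y) ≤
      ε * (δ * (deg w m x + deg w m y)) :=
    mul_le_mul_of_nonneg_left (by linarith) hε.le
  linarith

theorem lap_neg (w : V → V → ℝ) (m : V → ℝ) (f : V → ℝ) (x : V) :
    lap w m (-f) x = -lap w m f x := by
  simp only [lap, Pi.neg_apply]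
  rw [← mul_neg, ← finsum_neg_distrib]
  congr! 3
  ring

/-- **Lemma (Discrete-time Lipschitz contraction).** For `f ∈ Lip(1)`,
`0 < ε ≤ 1/(Deg(x)+Deg(y))` and `Hf = f + εΔf` one has
`|Hf(y) - Hf(x)| ≤ d(x,y)(1 - ε κ(x,y))`. -/
theorem discrete_time_lip_contraction {V : Type*} (w : V → V → ℝ) (m : V → ℝ)
    (d : V → V → ℝ) (hB : IsGraphBase w m d) (x y : V) (hxy : x ≠ y)
    (f : V → ℝ) (hf : Lip1 d f) (ε : ℝ) (hε : 0 < ε)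
    (hε' : ε ≤ 1 / (deg w m x + deg w m y)) :
    |(f y + ε * lap w m f y) - (f x + ε * lap w m f x)| ≤
      d x y * (1 - ε * kappa w m d x y) := by
  have hneg : Lip1 d (-f) := fun a b => by
    have hsymm : d a b = d b a := hB.2.2.2.2.2.2.2.1.2.2.1 a b
    simp only [Pi.neg_apply]
    linarith [hf b a]
  have h := discrete_time_lip_contraction_sub hB hxy hneg hε hε'
  simp only [lap_neg, Pi.neg_apply] at h
  exact abs_le.2 ⟨by linarith, discrete_time_lip_contraction_sub hB hxy hf hε hε'⟩

end SalamiPaper
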